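/- arXiv:1405.7293 — 4 statements merged into one kernel-verified Lean document; each statement's English description precedes it below -/
import Mathlib

section
/- Let f : ℝ^k → ℝ be continuous and suppose there exist constants a ≥ 0, K ≥ 0 and a strictly increasing convex function φ : [0,∞) → [0,∞) with φ(0) = 0 and φ continuous at 0, such that |f(x)| ≤ a + K·φ(|x|) for all x. For n ≥ 1 define f_n(x) = inf { f(u) + (n/2)·K·φ(2|u − x|) : u ∈ ℚ^k }. Then f_n is well-defined (the infimum is finite, i.e. > −∞, for every x), and for all x ∈ ℝ^k: −a − (1/2)·K·φ(2|x|) ≤ f_n(x) ≤ f(x) ≤ a + (1/2)·K·φ(2|x|); in particular |f_n(x)| ≤ a + (1/2)·K·φ(2|x|). -/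
/-- The set of points of `ℝ^k` with rational coordinates. -/
def ratPoints (k : ℕ) : Set (EuclideanSpace ℝ (Fin k)) :=
  {u | ∀ i, ∃ r : ℚ, u i = (r : ℝ)}

/-- The approximating infimal convolution `f_n`. -/
noncomputable def lowerApprox {k : ℕ} (f : EuclideanSpace ℝ (Fin k) → ℝ)
    (K : ℝ) (φ : ℝ → ℝ) (n : ℕ) (x : EuclideanSpace ℝ (Fin k)) : ℝ :=
  sInf ((fun u => f u + ((n : ℝ) / 2) * K * φ (2 * ‖u - x‖)) '' ratPoints k)

open Filter Topology

theorem dense_ratPoints (k : ℕ) : Dense (ratPoints k) := by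
  have hpi : Dense (Set.univ.pi fun _ : Fin k => Set.range ((↑) : ℚ → ℝ)) :=
    dense_pi _ fun _ _ => Rat.denseRange_cast
  convert hpi.preimage (EuclideanSpace.equiv (Fin k) ℝ).toHomeomorph.isOpenMap using 1
  ext u
  simp [ratPoints, eq_comm]

/-- The midpoint inequality for a convex monotone function composed with a norm. -/
theorem ConvexOn.map_norm_le_half_add_half {E : Type*} [SeminormedAddCommGroup E] {φ : ℝ → ℝ}
    (hconv : ConvexOn ℝ (Set.Ici 0) φ) (hmono : MonotoneOn φ (Set.Ici 0)) (u x : E) :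
    φ ‖u‖ ≤ (1 / 2) * φ (2 * ‖x‖) + (1 / 2) * φ (2 * ‖u - x‖) := by
  have htri : ‖u‖ ≤ ‖x‖ + ‖u - x‖ := norm_le_norm_add_norm_sub' u x
  have hmid := hconv.2 (Set.mem_Ici.2 (by positivity : 0 ≤ 2 * ‖x‖))
    (Set.mem_Ici.2 (by positivity : 0 ≤ 2 * ‖u - x‖))
    (by norm_num : (0 : ℝ) ≤ 1 / 2) (by norm_num : (0 : ℝ) ≤ 1 / 2) (by norm_num)
  simp only [smul_eq_mul] at hmid
  rw [show 1 / 2 * (2 * ‖x‖) + 1 / 2 * (2 * ‖u - x‖) = ‖x‖ + ‖u - x‖ by ring] at hmid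
  exact (hmono (norm_nonneg u) (Set.mem_Ici.2 (by positivity)) htri).trans hmid

theorem tendsto_penalized {E : Type*} [SeminormedAddCommGroup E] {f : E → ℝ} (hf : Continuous f)
    {φ : ℝ → ℝ} (hzero : φ 0 = 0) (hcont : ContinuousWithinAt φ (Set.Ici 0) 0) (c : ℝ) (x : E) :
    Tendsto (fun u => f u + c * φ (2 * ‖u - x‖)) (𝓝 x) (𝓝 (f x)) := by
  have harg : Tendsto (fun u => 2 * ‖u - x‖) (𝓝 x) (𝓝[Set.Ici 0] 0) := by
    refine tendsto_nhdsWithin_iff.2 ⟨?_, Eventually.of_forall fun u => ?_⟩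
    · have hdist : Continuous fun u => 2 * ‖u - x‖ := by fun_prop
      simpa using hdist.tendsto x
    · exact Set.mem_Ici.2 (by positivity)
  simpa [hzero] using (hf.tendsto x).add ((hcont.tendsto.comp harg).const_mul c)

/-- `f_n` is well-defined (the infimum is finite) and
`-a - (1/2) K φ(2|x|) ≤ f_n x ≤ f x ≤ a + (1/2) K φ(2|x|)`, in particular
`|f_n x| ≤ a + (1/2) K φ(2|x|)`. -/
theorem lowerApprox_wellDefined_and_bounds
    (k : ℕ) (hk : 1 ≤ k)
    (f : EuclideanSpace ℝ (Fin k) → ℝ) (hf : Continuous f)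
    (a K : ℝ) (ha : 0 ≤ a) (hK : 0 ≤ K)
    (φ : ℝ → ℝ)
    (hφ_nonneg : ∀ t ∈ Set.Ici (0 : ℝ), 0 ≤ φ t)
    (hφ_mono : StrictMonoOn φ (Set.Ici (0 : ℝ)))
    (hφ_conv : ConvexOn ℝ (Set.Ici (0 : ℝ)) φ)
    (hφ_zero : φ 0 = 0)
    (hφ_cont : ContinuousWithinAt φ (Set.Ici (0 : ℝ)) 0)
    (hbound : ∀ x, |f x| ≤ a + K * φ ‖x‖)
    (n : ℕ) (hn : 1 ≤ n) (x : EuclideanSpace ℝ (Fin k)) :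
    BddBelow ((fun u => f u + ((n : ℝ) / 2) * K * φ (2 * ‖u - x‖)) '' ratPoints k) ∧
      -a - (1 / 2) * K * φ (2 * ‖x‖) ≤ lowerApprox f K φ n x ∧
      lowerApprox f K φ n x ≤ f x ∧
      f x ≤ a + (1 / 2) * K * φ (2 * ‖x‖) ∧
      |lowerApprox f K φ n x| ≤ a + (1 / 2) * K * φ (2 * ‖x‖) := by
  have hmid := hφ_conv.map_norm_le_half_add_half (E := EuclideanSpace ℝ (Fin k))
    hφ_mono.monotoneOn
  have hlower : ∀ y ∈ (fun u => f u + ((n : ℝ) / 2) * K * φ (2 * ‖u - x‖)) '' ratPoints k,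
      -a - (1 / 2) * K * φ (2 * ‖x‖) ≤ y := by
    rintro _ ⟨u, -, rfl⟩
    have hn' : (1 : ℝ) ≤ n := by exact_mod_cast hn
    have hpen : 0 ≤ K * φ (2 * ‖u - x‖) :=
      mul_nonneg hK (hφ_nonneg _ (Set.mem_Ici.2 (by positivity)))
    have hfu := (abs_le.1 (hbound u)).1
    have hKmid := mul_le_mul_of_nonneg_left (hmid u x) hK
    have hscale := mul_le_mul_of_nonneg_right hn' hpen
    dsimp only
    linarith
  have hbdd : BddBelow ((fun u => f u + ((n : ℝ) / 2) * K * φ (2 * ‖u - x‖)) '' ratPoints k) :=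
    ⟨_, hlower⟩
  have hge : -a - (1 / 2) * K * φ (2 * ‖x‖) ≤ lowerApprox f K φ n x :=
    le_csInf ((dense_ratPoints k).nonempty.image _) hlower
  have hle : lowerApprox f K φ n x ≤ f x := by
    have : (𝓝[ratPoints k] x).NeBot := mem_closure_iff_nhdsWithin_neBot.1 (dense_ratPoints k x)
    refine ge_of_tendsto (x := 𝓝[ratPoints k] x)
      ((tendsto_penalized hf hφ_zero hφ_cont ((n : ℝ) / 2 * K) x).mono_left nhdsWithin_le_nhds) ?_
    filter_upwards [self_mem_nhdsWithin] with u hu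
    exact csInf_le hbdd (Set.mem_image_of_mem _ hu)
  have hup : f x ≤ a + (1 / 2) * K * φ (2 * ‖x‖) := by
    have hKmid := mul_le_mul_of_nonneg_left (hmid x x) hK
    simp only [sub_self, norm_zero, mul_zero, hφ_zero, add_zero] at hKmid
    linarith [(abs_le.1 (hbound x)).2]
  exact ⟨hbdd, hge, hle, hup, abs_le.2 ⟨by linarith, hle.trans hup⟩⟩
end

section
/- Let f : ℝ × ℝ^d × ℝ^m → ℝ be continuous and suppose there exist constants a ≥ 0, λ > 0 and a strictly increasing convex function φ : [0,∞) → [0,∞) with φ(0) = 0 and φ continuous at 0, such that |f(y,z,x)| ≤ a + φ(|y|) + λ(|z|² + |x|²) for all (y,z,x). For n ≥ 1 define f_n(y,z,x) = inf { f(u,v,w) + (n/2)·φ(2|u − y|) + 2nλ(|v − z|² + |w − x|²) : (u,v,w) ∈ ℚ^{1+d+m} }. Then f_n is well-defined, satisfies |f_n(y,z,x)| ≤ a + (1/2)·φ(2|y|) + 2λ(|z|² + |x|²), the sequence (f_n) is nondecreasing in n, f_n(y,z,x) ≤ f(y,z,x), and f_n(y,z,x) → f(y,z,x) as n → ∞ for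 every (y,z,x). -/
open Filter

/-- The set of points of `ℝ × ℝ^d × ℝ^m` with rational coordinates. -/
def ratPoints3 (d m : ℕ) :
    Set (ℝ × EuclideanSpace ℝ (Fin d) × EuclideanSpace ℝ (Fin m)) :=
  {p | (∃ r : ℚ, p.1 = (r : ℝ)) ∧ (∀ i, ∃ r : ℚ, p.2.1 i = (r : ℝ)) ∧
    (∀ i, ∃ r : ℚ, p.2.2 i = (r : ℝ))}

/-- The approximating infimal convolution `f_n` on `ℝ × ℝ^d × ℝ^m`. -/
noncomputable def lowerApprox3 {d m : ℕ}
    (f : ℝ × EuclideanSpace ℝ (Fin d) × EuclideanSpace ℝ (Fin m) → ℝ)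
    (lam : ℝ) (φ : ℝ → ℝ) (n : ℕ)
    (p : ℝ × EuclideanSpace ℝ (Fin d) × EuclideanSpace ℝ (Fin m)) : ℝ :=
  sInf ((fun q => f q + ((n : ℝ) / 2) * φ (2 * |q.1 - p.1|) +
      2 * (n : ℝ) * lam * (‖q.2.1 - p.2.1‖ ^ 2 + ‖q.2.2 - p.2.2‖ ^ 2)) '' ratPoints3 d m)

/-- The rational points are dense in a finite-dimensional Euclidean space. -/
theorem dense_rational_euclideanSpace (n : ℕ) :
    Dense {v : EuclideanSpace ℝ (Fin n) | ∀ i, ∃ r : ℚ, v i = (r : ℝ)} := by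
  have hpi : Dense (Set.univ.pi fun _ : Fin n => Set.range ((↑) : ℚ → ℝ)) :=
    dense_pi _ fun _ _ => Rat.denseRange_cast
  convert hpi.preimage (PiLp.homeomorph 2 fun _ : Fin n => ℝ).isOpenMap using 1
  ext v
  simp [Set.mem_pi, eq_comm, PiLp.homeomorph]

theorem dense_ratPoints3 (d m : ℕ) : Dense (ratPoints3 d m) := by
  have hprod := (Rat.denseRange_cast (𝕜 := ℝ)).prod
    ((dense_rational_euclideanSpace d).prod (dense_rational_euclideanSpace m))
  convert hprod using 1
  ext q
  simp [ratPoints3, eq_comm]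

section PenalizedInfimum

variable {X : Type*} {f g : X → ℝ} {D : Set X} {C : ℝ}

theorem neg_add_mul_le_add_mul (hlow : ∀ q, -C ≤ f q + g q) (n : ℕ) (q : X) :
    -C + ((n : ℝ) - 1) * g q ≤ f q + n * g q := by
  linarith [hlow q]

theorem neg_le_add_mul (hg : ∀ q, 0 ≤ g q) (hlow : ∀ q, -C ≤ f q + g q) {n : ℕ} (hn : 1 ≤ n)
    (q : X) : -C ≤ f q + n * g q := by
  have hn' : (0 : ℝ) ≤ n - 1 := sub_nonneg.2 (by exact_mod_cast hn)
  linarith [neg_add_mul_le_add_mul hlow n q, mul_nonneg hn' (hg q)]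

theorem bddBelow_image_add_mul (hg : ∀ q, 0 ≤ g q) (hlow : ∀ q, -C ≤ f q + g q) {n : ℕ}
    (hn : 1 ≤ n) : BddBelow ((fun q => f q + n * g q) '' D) :=
  ⟨-C, Set.forall_mem_image.2 fun q _ => neg_le_add_mul hg hlow hn q⟩

theorem sInf_image_add_mul_le_succ (hD : D.Nonempty) (hg : ∀ q, 0 ≤ g q)
    (hlow : ∀ q, -C ≤ f q + g q) {n : ℕ} (hn : 1 ≤ n) :
    sInf ((fun q => f q + n * g q) '' D) ≤
      sInf ((fun q => f q + ((n + 1 : ℕ) : ℝ) * g q) '' D) := by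
  refine le_csInf (hD.image _) (Set.forall_mem_image.2 fun q hq => ?_)
  refine (csInf_le (bddBelow_image_add_mul hg hlow hn) (Set.mem_image_of_mem _ hq)).trans ?_
  push_cast
  linarith [hg q]

variable [TopologicalSpace X] {p : X}

theorem sInf_image_add_mul_le (hD : Dense D) (hg : ∀ q, 0 ≤ g q) (hlow : ∀ q, -C ≤ f q + g q)
    (hf : ContinuousAt f p) (hgc : ContinuousAt g p) (hgp : g p = 0) {n : ℕ} (hn : 1 ≤ n) :
    sInf ((fun q => f q + n * g q) '' D) ≤ f p := by
  have hcont : Tendsto (fun q => f q + n * g q) (nhdsWithin p D) (nhds (f p)) := by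
    have h : Tendsto (fun q => f q + n * g q) (nhds p) (nhds (f p + n * g p)) :=
      hf.add (continuousAt_const.mul hgc)
    rw [hgp, mul_zero, add_zero] at h
    exact h.mono_left nhdsWithin_le_nhds
  have : (nhdsWithin p D).NeBot := mem_closure_iff_nhdsWithin_neBot.1 (hD p)
  refine ge_of_tendsto hcont ?_
  filter_upwards [self_mem_nhdsWithin] with q hq
  exact csInf_le (bddBelow_image_add_mul hg hlow hn) (Set.mem_image_of_mem _ hq)

theorem tendsto_sInf_image_add_mul (hD : Dense D) (hg : ∀ q, 0 ≤ g q)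
    (hlow : ∀ q, -C ≤ f q + g q) (hf : ContinuousAt f p) (hgc : ContinuousAt g p)
    (hgp : g p = 0) (hsep : ∀ U ∈ nhds p, ∃ c > 0, ∀ q ∉ U, c ≤ g q) :
    Tendsto (fun n : ℕ => sInf ((fun q => f q + n * g q) '' D)) atTop (nhds (f p)) := by
  have hne : D.Nonempty := hD.nonempty_iff.2 ⟨p⟩
  refine tendsto_order.2 ⟨fun b hb => ?_, fun b hb => ?_⟩
  · obtain ⟨b', hbb', hb'⟩ := exists_between hb
    obtain ⟨c, hc, hcU⟩ := hsep _ (hf.eventually (lt_mem_nhds hb'))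
    obtain ⟨N, hN⟩ := exists_nat_ge ((b' + C) / c + 1)
    filter_upwards [eventually_ge_atTop N, eventually_ge_atTop 1] with n hn hn1
    refine hbb'.trans_le (le_csInf (hne.image _) (Set.forall_mem_image.2 fun q _ => ?_))
    by_cases hq : b' < f q
    · exact hq.le.trans (le_add_of_nonneg_right (mul_nonneg n.cast_nonneg (hg q)))
    · have hNn : (N : ℝ) ≤ n := by exact_mod_cast hn
      have hn' : (0 : ℝ) ≤ n - 1 := sub_nonneg.2 (by exact_mod_cast hn1)
      have hlarge : b' + C ≤ ((n : ℝ) - 1) * c := (div_le_iff₀ hc).1 (by linarith)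
      linarith [neg_add_mul_le_add_mul hlow n q, mul_le_mul_of_nonneg_left (hcU q hq) hn']
  · filter_upwards [eventually_ge_atTop 1] with n hn
    exact (sInf_image_add_mul_le hD hg hlow hf hgc hgp hn).trans_lt hb

end PenalizedInfimum

theorem ConvexOn.map_le_half_add_half {φ : ℝ → ℝ} (hφ : ConvexOn ℝ (Set.Ici (0 : ℝ)) φ)
    (hmono : MonotoneOn φ (Set.Ici (0 : ℝ))) {r s t : ℝ} (hr : 0 ≤ r) (hs : 0 ≤ s) (ht : 0 ≤ t)
    (hrst : r ≤ s + t) : φ r ≤ 1 / 2 * φ (2 * s) + 1 / 2 * φ (2 * t) := by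
  have hconv := hφ.2 (show 2 * s ∈ Set.Ici (0 : ℝ) from Set.mem_Ici.2 (by positivity))
    (show 2 * t ∈ Set.Ici (0 : ℝ) from Set.mem_Ici.2 (by positivity))
    (show (0 : ℝ) ≤ 1 / 2 by norm_num) (show (0 : ℝ) ≤ 1 / 2 by norm_num) (by norm_num)
  simp only [smul_eq_mul] at hconv
  refine (hmono hr (Set.mem_Ici.2 (by positivity)) hrst).trans ?_
  convert hconv using 2
  ring

theorem sq_norm_le_two_mul_sq_norm_sub_add {E : Type*} [SeminormedAddCommGroup E] (v z : E) :
    ‖v‖ ^ 2 ≤ 2 * (‖v - z‖ ^ 2 + ‖z‖ ^ 2) := by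
  have h : ‖v‖ ≤ ‖v - z‖ + ‖z‖ := by simpa using norm_add_le (v - z) z
  nlinarith [norm_nonneg v, sq_nonneg (‖v - z‖ - ‖z‖)]

section Penalty

variable {E F : Type*} [SeminormedAddCommGroup E] [SeminormedAddCommGroup F]

/-- The penalty in the infimal convolution, per unit of the index `n`. -/
noncomputable def convolutionPenalty (lam : ℝ) (φ : ℝ → ℝ) (p q : ℝ × E × F) : ℝ :=
  1 / 2 * φ (2 * |q.1 - p.1|) + 2 * lam * (‖q.2.1 - p.2.1‖ ^ 2 + ‖q.2.2 - p.2.2‖ ^ 2)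

variable {lam : ℝ} {φ : ℝ → ℝ}

theorem convolutionPenalty_self (hφ_zero : φ 0 = 0) (p : ℝ × E × F) :
    convolutionPenalty lam φ p p = 0 := by
  simp [convolutionPenalty, hφ_zero]

theorem convolutionPenalty_nonneg (hlam : 0 ≤ lam)
    (hφ_nonneg : ∀ t ∈ Set.Ici (0 : ℝ), 0 ≤ φ t) (p q : ℝ × E × F) :
    0 ≤ convolutionPenalty lam φ p q := by
  have := hφ_nonneg (2 * |q.1 - p.1|) (Set.mem_Ici.2 (by positivity))
  unfold convolutionPenalty
  positivity

theorem continuousAt_convolutionPenalty (hφ_cont : ContinuousWithinAt φ (Set.Ici (0 : ℝ)) 0)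
    (p : ℝ × E × F) : ContinuousAt (convolutionPenalty lam φ p) p := by
  have hφ : ContinuousAt (fun q : ℝ × E × F => φ (2 * |q.1 - p.1|)) p := by
    have h0 : (2 : ℝ) * |p.1 - p.1| = 0 := by simp
    have hlin : ContinuousWithinAt (fun q : ℝ × E × F => 2 * |q.1 - p.1|) Set.univ p := by
      fun_prop
    refine (continuousWithinAt_univ _ _).1 (ContinuousWithinAt.comp (t := Set.Ici 0) ?_ hlin ?_)
    · rwa [h0]
    · intro q _
      exact Set.mem_Ici.2 (by positivity)
  have hsq : ContinuousAt
      (fun q : ℝ × E × F => 2 * lam * (‖q.2.1 - p.2.1‖ ^ 2 + ‖q.2.2 - p.2.2‖ ^ 2)) p := by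
    fun_prop
  exact (continuousAt_const.mul hφ).add hsq

theorem exists_pos_le_convolutionPenalty (hlam : 0 < lam)
    (hφ_nonneg : ∀ t ∈ Set.Ici (0 : ℝ), 0 ≤ φ t) (hφ_mono : StrictMonoOn φ (Set.Ici (0 : ℝ)))
    (hφ_zero : φ 0 = 0) (p : ℝ × E × F) {U : Set (ℝ × E × F)} (hU : U ∈ nhds p) :
    ∃ c > 0, ∀ q ∉ U, c ≤ convolutionPenalty lam φ p q := by
  obtain ⟨δ, hδ, hball⟩ := Metric.mem_nhds_iff.1 hU
  have h2δ : (2 * δ) ∈ Set.Ici (0 : ℝ) := Set.mem_Ici.2 (by positivity)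
  have hφδ : 0 < φ (2 * δ) := by
    simpa [hφ_zero] using hφ_mono Set.self_mem_Ici h2δ (by positivity)
  refine ⟨min (1 / 2 * φ (2 * δ)) (2 * lam * δ ^ 2), by positivity, fun q hq => ?_⟩
  have hdist : δ ≤ |q.1 - p.1| ∨ δ ≤ ‖q.2.1 - p.2.1‖ ∨ δ ≤ ‖q.2.2 - p.2.2‖ := by
    have hqδ : δ ≤ dist q p := not_lt.1 fun h => hq (hball h)
    rwa [Prod.dist_eq, Prod.dist_eq, le_max_iff, le_max_iff, Real.dist_eq, dist_eq_norm,
      dist_eq_norm] at hqδ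
  have hφq := hφ_nonneg (2 * |q.1 - p.1|) (Set.mem_Ici.2 (by positivity))
  unfold convolutionPenalty
  rcases hdist with h | h | h
  · refine (min_le_left _ _).trans ?_
    have := hφ_mono.monotoneOn h2δ (Set.mem_Ici.2 (by positivity))
      (mul_le_mul_of_nonneg_left h zero_le_two)
    have : 0 ≤ 2 * lam * (‖q.2.1 - p.2.1‖ ^ 2 + ‖q.2.2 - p.2.2‖ ^ 2) := by positivity
    linarith
  · calc _ ≤ 2 * lam * δ ^ 2 := min_le_right _ _
      _ ≤ 2 * lam * (‖q.2.1 - p.2.1‖ ^ 2 + ‖q.2.2 - p.2.2‖ ^ 2) := by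
        gcongr
        exact (pow_le_pow_left₀ hδ.le h 2).trans (le_add_of_nonneg_right (sq_nonneg _))
      _ ≤ _ := le_add_of_nonneg_left (by positivity)
  · calc _ ≤ 2 * lam * δ ^ 2 := min_le_right _ _
      _ ≤ 2 * lam * (‖q.2.1 - p.2.1‖ ^ 2 + ‖q.2.2 - p.2.2‖ ^ 2) := by
        gcongr
        exact (pow_le_pow_left₀ hδ.le h 2).trans (le_add_of_nonneg_left (sq_nonneg _))
      _ ≤ _ := le_add_of_nonneg_left (by positivity)

theorem growth_le_add_convolutionPenalty (hlam : 0 ≤ lam)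
    (hφ_mono : MonotoneOn φ (Set.Ici (0 : ℝ))) (hφ_conv : ConvexOn ℝ (Set.Ici (0 : ℝ)) φ)
    (p q : ℝ × E × F) :
    φ |q.1| + lam * (‖q.2.1‖ ^ 2 + ‖q.2.2‖ ^ 2) ≤
      1 / 2 * φ (2 * |p.1|) + 2 * lam * (‖p.2.1‖ ^ 2 + ‖p.2.2‖ ^ 2) +
        convolutionPenalty lam φ p q := by
  have hφq := hφ_conv.map_le_half_add_half hφ_mono (abs_nonneg q.1) (abs_nonneg (q.1 - p.1))
    (abs_nonneg p.1) (by simpa using abs_add_le (q.1 - p.1) p.1)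
  have hsq := mul_le_mul_of_nonneg_left
    (add_le_add (sq_norm_le_two_mul_sq_norm_sub_add q.2.1 p.2.1)
      (sq_norm_le_two_mul_sq_norm_sub_add q.2.2 p.2.2)) hlam
  unfold convolutionPenalty
  linarith

end Penalty

/-- properties of the lower approximating sequence `f_n`. -/
theorem lowerApprox3_properties
    (d m : ℕ) (hd : 1 ≤ d) (hm : 1 ≤ m)
    (f : ℝ × EuclideanSpace ℝ (Fin d) × EuclideanSpace ℝ (Fin m) → ℝ)
    (hf : Continuous f)
    (a lam : ℝ) (ha : 0 ≤ a) (hlam : 0 < lam)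
    (φ : ℝ → ℝ)
    (hφ_nonneg : ∀ t ∈ Set.Ici (0 : ℝ), 0 ≤ φ t)
    (hφ_mono : StrictMonoOn φ (Set.Ici (0 : ℝ)))
    (hφ_conv : ConvexOn ℝ (Set.Ici (0 : ℝ)) φ)
    (hφ_zero : φ 0 = 0)
    (hφ_cont : ContinuousWithinAt φ (Set.Ici (0 : ℝ)) 0)
    (hbound : ∀ p : ℝ × EuclideanSpace ℝ (Fin d) × EuclideanSpace ℝ (Fin m),
      |f p| ≤ a + φ |p.1| + lam * (‖p.2.1‖ ^ 2 + ‖p.2.2‖ ^ 2))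
    (p : ℝ × EuclideanSpace ℝ (Fin d) × EuclideanSpace ℝ (Fin m)) :
    (∀ n : ℕ, 1 ≤ n →
        BddBelow ((fun q => f q + ((n : ℝ) / 2) * φ (2 * |q.1 - p.1|) +
          2 * (n : ℝ) * lam * (‖q.2.1 - p.2.1‖ ^ 2 + ‖q.2.2 - p.2.2‖ ^ 2)) ''
            ratPoints3 d m)) ∧
    (∀ n : ℕ, 1 ≤ n → |lowerApprox3 f lam φ n p| ≤
        a + (1 / 2) * φ (2 * |p.1|) + 2 * lam * (‖p.2.1‖ ^ 2 + ‖p.2.2‖ ^ 2)) ∧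
    (∀ n : ℕ, 1 ≤ n → lowerApprox3 f lam φ n p ≤ lowerApprox3 f lam φ (n + 1) p) ∧
    (∀ n : ℕ, 1 ≤ n → lowerApprox3 f lam φ n p ≤ f p) ∧
    Tendsto (fun n => lowerApprox3 f lam φ n p) atTop (nhds (f p)) := by
  have hgrow := growth_le_add_convolutionPenalty hlam.le hφ_mono.monotoneOn hφ_conv p
  have hg := convolutionPenalty_nonneg hlam.le hφ_nonneg p
  have hgc := continuousAt_convolutionPenalty (lam := lam) hφ_cont p
  have hgp := convolutionPenalty_self (lam := lam) hφ_zero p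
  have hlow : ∀ q, -(a + 1 / 2 * φ (2 * |p.1|) + 2 * lam * (‖p.2.1‖ ^ 2 + ‖p.2.2‖ ^ 2)) ≤
      f q + convolutionPenalty lam φ p q := fun q => by
    linarith [(abs_le.1 (hbound q)).1, hgrow q]
  have hD := dense_ratPoints3 d m
  have hne := hD.nonempty_iff.2 ⟨p⟩
  have hobj (n : ℕ) : (fun q => f q + ((n : ℝ) / 2) * φ (2 * |q.1 - p.1|) +
      2 * (n : ℝ) * lam * (‖q.2.1 - p.2.1‖ ^ 2 + ‖q.2.2 - p.2.2‖ ^ 2)) =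
      fun q => f q + n * convolutionPenalty lam φ p q := by
    funext q
    unfold convolutionPenalty
    ring
  simp only [lowerApprox3, hobj]
  have hle (n : ℕ) (hn : 1 ≤ n) := sInf_image_add_mul_le hD hg hlow hf.continuousAt hgc hgp hn
  refine ⟨fun n hn => bddBelow_image_add_mul hg hlow hn, fun n hn => abs_le.2 ⟨?_, ?_⟩,
    fun n hn => sInf_image_add_mul_le_succ hne hg hlow hn, hle,
    tendsto_sInf_image_add_mul hD hg hlow hf.continuousAt hgc hgp fun U hU =>
      exists_pos_le_convolutionPenalty hlam hφ_nonneg hφ_mono hφ_zero p hU⟩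
  · exact le_csInf (hne.image _) (Set.forall_mem_image.2 fun q _ => neg_le_add_mul hg hlow hn q)
  · linarith [hle n hn, (abs_le.1 (hbound p)).2, hgrow p]
end

section
/- Let f : ℝ × ℝ^d × ℝ^m → ℝ be continuous with |f(y,z,x)| ≤ a + φ(|y|) + λ(|z|² + |x|²) for all (y,z,x), where a ≥ 0, λ > 0 are constants and φ : [0,∞) → [0,∞) is a strictly increasing convex function with φ(0) = 0 and φ continuous at 0. For n ≥ 1 define f^n(y,z,x) = sup { f(u,v,w) − (n/2)·φ(2|u − y|) − 2nλ(|v − z|² + |w − x|²) : (u,v,w) ∈ ℚ^{1+d+m} }. Then f^n is well-defined, satisfies |f^n(y,z,x)| ≤ a + (1/2)·φ(2|y|) + 2λ(|z|² + |x|²), the sequence (f^n) is nonincreasing in n, f^n(y,z,x) ≥ f(y,z,x), and f^n(y,z,x) → f(y,z,x) as n → ∞ for every (y,z,x). -/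
open Filter

/-- The approximating supremal convolution `f^n` on `ℝ × ℝ^d × ℝ^m`. -/
noncomputable def upperApprox3 {d m : ℕ}
    (f : ℝ × EuclideanSpace ℝ (Fin d) × EuclideanSpace ℝ (Fin m) → ℝ)
    (lam : ℝ) (φ : ℝ → ℝ) (n : ℕ)
    (p : ℝ × EuclideanSpace ℝ (Fin d) × EuclideanSpace ℝ (Fin m)) : ℝ :=
  sSup ((fun q => f q - ((n : ℝ) / 2) * φ (2 * |q.1 - p.1|) -
      2 * (n : ℝ) * lam * (‖q.2.1 - p.2.1‖ ^ 2 + ‖q.2.2 - p.2.2‖ ^ 2)) '' ratPoints3 d m)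

theorem dense_euclidean_rat (k : ℕ) :
    Dense {x : EuclideanSpace ℝ (Fin k) | ∀ i, ∃ r : ℚ, x i = (r : ℝ)} := by
  have h : Dense (Set.pi Set.univ fun _ : Fin k => Set.range ((↑) : ℚ → ℝ)) :=
    dense_pi _ fun _ _ => Rat.denseRange_cast
  convert h.preimage (EuclideanSpace.equiv (Fin k) ℝ).toHomeomorph.isOpenMap using 1
  ext x
  simp [Set.mem_pi, eq_comm]

theorem ConvexOn.map_abs_le_half_add_half {φ : ℝ → ℝ} (hconv : ConvexOn ℝ (Set.Ici 0) φ)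
    (hmono : MonotoneOn φ (Set.Ici 0)) (u y : ℝ) :
    φ |u| ≤ 1 / 2 * φ (2 * |u - y|) + 1 / 2 * φ (2 * |y|) := by
  have h1 : |u| ≤ |u - y| + |y| := by simpa using abs_add_le (u - y) y
  have h2 : φ |u| ≤ φ (|u - y| + |y|) :=
    hmono (abs_nonneg u) (add_nonneg (abs_nonneg (u - y)) (abs_nonneg y)) h1
  have h3 := hconv.2 (show 2 * |u - y| ∈ Set.Ici 0 by simp)
    (show 2 * |y| ∈ Set.Ici 0 by simp) (show (0 : ℝ) ≤ 1 / 2 by norm_num)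
    (show (0 : ℝ) ≤ 1 / 2 by norm_num) (by norm_num)
  simp only [smul_eq_mul] at h3
  rw [show 1 / 2 * (2 * |u - y|) + 1 / 2 * (2 * |y|) = |u - y| + |y| by ring] at h3
  exact h2.trans h3

theorem norm_sq_le_two_mul_sub {E : Type*} [SeminormedAddCommGroup E] (v z : E) :
    ‖v‖ ^ 2 ≤ 2 * ‖v - z‖ ^ 2 + 2 * ‖z‖ ^ 2 := by
  have h1 : ‖v‖ ≤ ‖v - z‖ + ‖z‖ := by simpa using norm_add_le (v - z) z
  nlinarith [norm_nonneg v, sq_nonneg (‖v - z‖ - ‖z‖)]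

/-- properties of the upper approximating sequence `f^n`. -/
theorem upperApprox3_properties
    (d m : ℕ) (hd : 1 ≤ d) (hm : 1 ≤ m)
    (f : ℝ × EuclideanSpace ℝ (Fin d) × EuclideanSpace ℝ (Fin m) → ℝ)
    (hf : Continuous f)
    (a lam : ℝ) (ha : 0 ≤ a) (hlam : 0 < lam)
    (φ : ℝ → ℝ)
    (hφ_nonneg : ∀ t ∈ Set.Ici (0 : ℝ), 0 ≤ φ t)
    (hφ_mono : StrictMonoOn φ (Set.Ici (0 : ℝ)))
    (hφ_conv : ConvexOn ℝ (Set.Ici (0 : ℝ)) φ)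
    (hφ_zero : φ 0 = 0)
    (hφ_cont : ContinuousWithinAt φ (Set.Ici (0 : ℝ)) 0)
    (hbound : ∀ p : ℝ × EuclideanSpace ℝ (Fin d) × EuclideanSpace ℝ (Fin m),
      |f p| ≤ a + φ |p.1| + lam * (‖p.2.1‖ ^ 2 + ‖p.2.2‖ ^ 2))
    (p : ℝ × EuclideanSpace ℝ (Fin d) × EuclideanSpace ℝ (Fin m)) :
    (∀ n : ℕ, 1 ≤ n →
        BddAbove ((fun q => f q - ((n : ℝ) / 2) * φ (2 * |q.1 - p.1|) -
          2 * (n : ℝ) * lam * (‖q.2.1 - p.2.1‖ ^ 2 + ‖q.2.2 - p.2.2‖ ^ 2)) ''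
            ratPoints3 d m)) ∧
    (∀ n : ℕ, 1 ≤ n → |upperApprox3 f lam φ n p| ≤
        a + (1 / 2) * φ (2 * |p.1|) + 2 * lam * (‖p.2.1‖ ^ 2 + ‖p.2.2‖ ^ 2)) ∧
    (∀ n : ℕ, 1 ≤ n → upperApprox3 f lam φ (n + 1) p ≤ upperApprox3 f lam φ n p) ∧
    (∀ n : ℕ, 1 ≤ n → f p ≤ upperApprox3 f lam φ n p) ∧
    Tendsto (fun n => upperApprox3 f lam φ n p) atTop (nhds (f p)) := by
  set g : ℕ → ℝ × EuclideanSpace ℝ (Fin d) × EuclideanSpace ℝ (Fin m) → ℝ := fun n q =>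
    f q - ((n : ℝ) / 2) * φ (2 * |q.1 - p.1|) -
      2 * (n : ℝ) * lam * (‖q.2.1 - p.2.1‖ ^ 2 + ‖q.2.2 - p.2.2‖ ^ 2) with hg
  set C : ℝ := a + (1 / 2) * φ (2 * |p.1|) + 2 * lam * (‖p.2.1‖ ^ 2 + ‖p.2.2‖ ^ 2) with hC
  have hne : (ratPoints3 d m).Nonempty := (dense_ratPoints3 d m).nonempty
  have hpen : ∀ q : ℝ × EuclideanSpace ℝ (Fin d) × EuclideanSpace ℝ (Fin m),
      0 ≤ φ (2 * |q.1 - p.1|) := fun q => hφ_nonneg _ (by simp)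
  have hgC : ∀ (n : ℕ) q, g n q ≤ C - ((n : ℝ) - 1) * (1 / 2 * φ (2 * |q.1 - p.1|) +
      2 * lam * (‖q.2.1 - p.2.1‖ ^ 2 + ‖q.2.2 - p.2.2‖ ^ 2)) := by
    intro n q
    have h1 := (abs_le.1 (hbound q)).2
    have h2 := hφ_conv.map_abs_le_half_add_half hφ_mono.monotoneOn q.1 p.1
    have h3 := mul_le_mul_of_nonneg_left (norm_sq_le_two_mul_sub q.2.1 p.2.1) hlam.le
    have h4 := mul_le_mul_of_nonneg_left (norm_sq_le_two_mul_sub q.2.2 p.2.2) hlam.le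
    simp only [hg, hC]
    linarith
  have hgle : ∀ n : ℕ, 1 ≤ n → ∀ q, g n q ≤ C := by
    intro n hn q
    have hn' : (0 : ℝ) ≤ (n : ℝ) - 1 := sub_nonneg.2 (by exact_mod_cast hn)
    refine (hgC n q).trans (sub_le_self _ (mul_nonneg hn' ?_))
    have := hpen q
    positivity
  have hbdd : ∀ n : ℕ, 1 ≤ n → BddAbove (g n '' ratPoints3 d m) := by
    rintro n hn
    refine ⟨C, ?_⟩
    rintro _ ⟨q, -, rfl⟩
    exact hgle n hn q
  have hge : ∀ n : ℕ, 1 ≤ n → f p ≤ upperApprox3 f lam φ n p := by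
    intro n hn
    have hφt : Tendsto (fun q : ℝ × EuclideanSpace ℝ (Fin d) × EuclideanSpace ℝ (Fin m) =>
        φ (2 * |q.1 - p.1|)) (nhds p) (nhds 0) := by
      have h0 : Tendsto φ (nhdsWithin 0 (Set.Ici 0)) (nhds 0) := by
        simpa [ContinuousWithinAt, hφ_zero] using hφ_cont
      refine h0.comp (tendsto_nhdsWithin_iff.2 ⟨?_, Eventually.of_forall fun q => by simp⟩)
      have : Continuous fun q : ℝ × EuclideanSpace ℝ (Fin d) × EuclideanSpace ℝ (Fin m) =>
        2 * |q.1 - p.1| := by fun_prop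
      simpa using this.tendsto p
    have hnt : Tendsto (fun q : ℝ × EuclideanSpace ℝ (Fin d) × EuclideanSpace ℝ (Fin m) =>
        2 * (n : ℝ) * lam * (‖q.2.1 - p.2.1‖ ^ 2 + ‖q.2.2 - p.2.2‖ ^ 2))
        (nhds p) (nhds 0) := by
      have : Continuous fun q : ℝ × EuclideanSpace ℝ (Fin d) × EuclideanSpace ℝ (Fin m) =>
        2 * (n : ℝ) * lam * (‖q.2.1 - p.2.1‖ ^ 2 + ‖q.2.2 - p.2.2‖ ^ 2) := by fun_prop
      simpa using this.tendsto p
    have hgt : Tendsto (g n) (nhds p) (nhds (f p)) := by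
      simpa using ((hf.tendsto p).sub (hφt.const_mul ((n : ℝ) / 2))).sub hnt
    have : (nhdsWithin p (ratPoints3 d m)).NeBot :=
      mem_closure_iff_nhdsWithin_neBot.1 (dense_ratPoints3 d m p)
    refine le_of_tendsto (hgt.mono_left (nhdsWithin_le_nhds (s := ratPoints3 d m))) ?_
    filter_upwards [self_mem_nhdsWithin] with q hq
    exact le_csSup (hbdd n hn) ⟨q, hq, rfl⟩
  refine ⟨hbdd, ?_, ?_, hge, ?_⟩
  · intro n hn
    refine abs_le.2 ⟨?_, ?_⟩
    · refine le_trans ?_ (hge n hn)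
      have h1 := (abs_le.1 (hbound p)).1
      have h2 := hφ_conv.map_abs_le_half_add_half hφ_mono.monotoneOn p.1 p.1
      rw [sub_self, abs_zero, mul_zero, hφ_zero] at h2
      have h3 : 0 ≤ lam * (‖p.2.1‖ ^ 2 + ‖p.2.2‖ ^ 2) := by positivity
      simp only [hC]
      linarith
    · refine csSup_le (hne.image _) ?_
      rintro _ ⟨q, -, rfl⟩
      exact hgle n hn q
  · intro n hn
    refine csSup_le (hne.image _) ?_
    rintro _ ⟨q, hq, rfl⟩
    refine le_trans ?_ (le_csSup (hbdd n hn) ⟨q, hq, rfl⟩)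
    have h1 := hpen q
    have h2 : 0 ≤ lam * (‖q.2.1 - p.2.1‖ ^ 2 + ‖q.2.2 - p.2.2‖ ^ 2) := by positivity
    push_cast
    linarith
  · refine tendsto_order.2 ⟨fun b hb => ?_, fun b hb => ?_⟩
    · filter_upwards [eventually_ge_atTop 1] with n hn
      exact hb.trans_le (hge n hn)
    · obtain ⟨b', hb', hb'b⟩ := exists_between hb
      obtain ⟨δ, hδ, hball⟩ := Metric.eventually_nhds_iff.1
        ((hf.tendsto p).eventually (gt_mem_nhds hb'))
      set c : ℝ := min (1 / 2 * φ (2 * δ)) (2 * lam * δ ^ 2) with hc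
      have hφδ : 0 < φ (2 * δ) := by
        have := hφ_mono (a := 0) (b := 2 * δ) (by simp) (by simp [hδ.le]) (by linarith)
        rwa [hφ_zero] at this
      have hcpos : 0 < c := lt_min (by positivity) (by positivity)
      have hfar : ∀ q : ℝ × EuclideanSpace ℝ (Fin d) × EuclideanSpace ℝ (Fin m),
          δ ≤ dist q p → c ≤ 1 / 2 * φ (2 * |q.1 - p.1|) +
            2 * lam * (‖q.2.1 - p.2.1‖ ^ 2 + ‖q.2.2 - p.2.2‖ ^ 2) := by
        intro q hq
        have h0 := hpen q
        have h1 : 0 ≤ lam * ‖q.2.1 - p.2.1‖ ^ 2 := by positivity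
        have h2 : 0 ≤ lam * ‖q.2.2 - p.2.2‖ ^ 2 := by positivity
        rw [Prod.dist_eq, Prod.dist_eq, le_max_iff, le_max_iff, Real.dist_eq, dist_eq_norm,
          dist_eq_norm] at hq
        rcases hq with hq | hq | hq
        · have h3 : φ (2 * δ) ≤ φ (2 * |q.1 - p.1|) :=
            hφ_mono.monotoneOn (by simp [hδ.le]) (by simp) (by linarith)
          linarith [min_le_left (1 / 2 * φ (2 * δ)) (2 * lam * δ ^ 2)]
        · have h3 : lam * δ ^ 2 ≤ lam * ‖q.2.1 - p.2.1‖ ^ 2 := by gcongr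
          linarith [min_le_right (1 / 2 * φ (2 * δ)) (2 * lam * δ ^ 2)]
        · have h3 : lam * δ ^ 2 ≤ lam * ‖q.2.2 - p.2.2‖ ^ 2 := by gcongr
          linarith [min_le_right (1 / 2 * φ (2 * δ)) (2 * lam * δ ^ 2)]
      obtain ⟨N, hN⟩ := exists_nat_ge ((C - b') / c + 1)
      filter_upwards [eventually_ge_atTop 1, eventually_ge_atTop N] with n hn hnN
      refine lt_of_le_of_lt (csSup_le (hne.image _) ?_) hb'b
      rintro _ ⟨q, -, rfl⟩
      have hn' : (0 : ℝ) ≤ (n : ℝ) - 1 := sub_nonneg.2 (by exact_mod_cast hn)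
      rcases lt_or_ge (dist q p) δ with hq | hq
      · have h1 : f q < b' := hball hq
        have h2 : 0 ≤ (n : ℝ) / 2 * φ (2 * |q.1 - p.1|) :=
          mul_nonneg (by positivity) (hpen q)
        have h3 : 0 ≤ 2 * (n : ℝ) * lam * (‖q.2.1 - p.2.1‖ ^ 2 + ‖q.2.2 - p.2.2‖ ^ 2) := by
          positivity
        linarith
      · have h1 := mul_le_mul_of_nonneg_left (hfar q hq) hn'
        have h2 : (N : ℝ) ≤ n := by exact_mod_cast hnN
        have h3 : (C - b') / c ≤ (n : ℝ) - 1 := by linarith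
        rw [div_le_iff₀ hcpos] at h3
        exact (hgC n q).trans (by linarith)
end

section
/- Let f : ℝ × ℝ^d × ℝ^m → ℝ be continuous with |f(y,z,x)| ≤ a + φ(|y|) + λ(|z|² + |x|²) for all (y,z,x), where a ≥ 0, λ > 0 are constants and φ : [0,∞) → [0,∞) is a strictly increasing convex function with φ(0) = 0 and φ continuous at 0. Fix (y,x) ∈ ℝ × ℝ^m. Then there exists a sequence of nonnegative reals (c_n) with c_n ≤ 2(a + (1/2)·φ(2|y|) + 2λ|x|²) + 2|f(y,0,x)| for all n, c_n → 0 as n → ∞, and for every n ≥ 1 and every (ȳ, z̄, x̄) ∈ ℝ × ℝ^d × ℝ^m: |f(ȳ, z̄, x̄) − f(y, 0, x)| ≤ (n/2)·φ(2|ȳ − y|) + 2nλ(|z̄|² + |x̄ − x|²) + c_n. -/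
open Filter

/-- If `D ≤ G + M` and `D` is small wherever `G` is small, then `D ≤ n G + c n` for some
sequence `c` with values in `[0, M]` that tends to `0`. -/
theorem exists_tendsto_zero_le_mul_add {X : Type*} [Nonempty X] (D G : X → ℝ) (M : ℝ)
    (hM : 0 ≤ M) (hG : ∀ p, 0 ≤ G p) (hDG : ∀ p, D p ≤ G p + M)
    (hsmall : ∀ ε > 0, ∃ η > 0, ∀ p, G p < η → D p < ε) :
    ∃ c : ℕ → ℝ, (∀ n, 0 ≤ c n) ∧ (∀ n, c n ≤ M) ∧ Tendsto c atTop (nhds 0) ∧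
      ∀ n : ℕ, 1 ≤ n → ∀ p, D p ≤ n * G p + c n := by
  have hle : ∀ n : ℕ, 1 ≤ n → ∀ p, max (D p - n * G p) 0 ≤ M := fun n hn p ↦ by
    have hn' : (1 : ℝ) ≤ n := by exact_mod_cast hn
    exact max_le (by nlinarith [hG p, hDG p]) hM
  refine ⟨fun n ↦ if 1 ≤ n then ⨆ p, max (D p - n * G p) 0 else 0, fun n ↦ ?_, fun n ↦ ?_, ?_,
    fun n hn p ↦ ?_⟩
  · dsimp only
    split_ifs
    · exact Real.iSup_nonneg fun p ↦ le_max_right _ _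
    · exact le_rfl
  · dsimp only
    split_ifs with hn
    · exact ciSup_le (hle n hn)
    · exact hM
  · rw [Metric.tendsto_atTop]
    intro ε hε
    obtain ⟨η, hη, h⟩ := hsmall (ε / 2) (half_pos hε)
    obtain ⟨N, hN⟩ := exists_nat_gt (M / η + 1)
    refine ⟨N + 1, fun n hn ↦ ?_⟩
    have hn1 : 1 ≤ n := by omega
    have hnN : (N : ℝ) ≤ n := by exact_mod_cast (by omega : N ≤ n)
    have hn1' : (1 : ℝ) ≤ n := by exact_mod_cast hn1
    have hMn : M ≤ (n - 1) * η := by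
      rw [← div_le_iff₀ hη]
      linarith
    have hsup : ⨆ p, max (D p - n * G p) 0 ≤ ε / 2 := by
      refine ciSup_le fun p ↦ max_le ?_ (half_pos hε).le
      rcases lt_or_ge (G p) η with hp | hp
      · nlinarith [h p hp, hG p]
      · nlinarith [hDG p, mul_le_mul_of_nonneg_left hp (sub_nonneg.2 hn1')]
    rw [if_pos hn1, Real.dist_0_eq_abs, abs_of_nonneg (Real.iSup_nonneg fun p ↦ le_max_right _ _)]
    linarith
  · have hbdd : BddAbove (Set.range fun p ↦ max (D p - n * G p) 0) :=
      ⟨M, by rintro _ ⟨q, rfl⟩; exact hle n hn q⟩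
    have h := (le_max_left _ _).trans (le_ciSup hbdd p)
    simp only [if_pos hn]
    linarith

/-- for fixed `(y, x)` there is a nonnegative sequence `c_n → 0`,
bounded by `2(a + (1/2)φ(2|y|) + 2λ|x|²) + 2|f(y,0,x)|`, such that
`|f(ȳ,z̄,x̄) − f(y,0,x)| ≤ (n/2)φ(2|ȳ−y|) + 2nλ(|z̄|² + |x̄−x|²) + c_n`. -/
theorem exists_modulus_sequence
    (d m : ℕ) (hd : 1 ≤ d) (hm : 1 ≤ m)
    (f : ℝ × EuclideanSpace ℝ (Fin d) × EuclideanSpace ℝ (Fin m) → ℝ)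
    (hf : Continuous f)
    (a lam : ℝ) (ha : 0 ≤ a) (hlam : 0 < lam)
    (φ : ℝ → ℝ)
    (hφ_nonneg : ∀ t ∈ Set.Ici (0 : ℝ), 0 ≤ φ t)
    (hφ_mono : StrictMonoOn φ (Set.Ici (0 : ℝ)))
    (hφ_conv : ConvexOn ℝ (Set.Ici (0 : ℝ)) φ)
    (hφ_zero : φ 0 = 0)
    (hφ_cont : ContinuousWithinAt φ (Set.Ici (0 : ℝ)) 0)
    (hbound : ∀ p : ℝ × EuclideanSpace ℝ (Fin d) × EuclideanSpace ℝ (Fin m),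
      |f p| ≤ a + φ |p.1| + lam * (‖p.2.1‖ ^ 2 + ‖p.2.2‖ ^ 2))
    (y : ℝ) (x : EuclideanSpace ℝ (Fin m)) :
    ∃ c : ℕ → ℝ,
      (∀ n, 0 ≤ c n) ∧
      (∀ n, c n ≤ 2 * (a + (1 / 2) * φ (2 * |y|) + 2 * lam * ‖x‖ ^ 2) +
        2 * |f (y, 0, x)|) ∧
      Tendsto c atTop (nhds 0) ∧
      (∀ n : ℕ, 1 ≤ n →
        ∀ (ybar : ℝ) (zbar : EuclideanSpace ℝ (Fin d)) (xbar : EuclideanSpace ℝ (Fin m)),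
          |f (ybar, zbar, xbar) - f (y, 0, x)| ≤
            ((n : ℝ) / 2) * φ (2 * |ybar - y|) +
              2 * (n : ℝ) * lam * (‖zbar‖ ^ 2 + ‖xbar - x‖ ^ 2) + c n) := by
  have hφabs : ∀ t : ℝ, 0 ≤ φ (2 * |t|) := fun t ↦ hφ_nonneg _ (by simp)
  obtain ⟨c, hc0, hcM, hct, hc⟩ := exists_tendsto_zero_le_mul_add
    (fun p : ℝ × EuclideanSpace ℝ (Fin d) × EuclideanSpace ℝ (Fin m) ↦ |f p - f (y, 0, x)|)
    (fun p ↦ 1 / 2 * φ (2 * |p.1 - y|) + 2 * lam * (‖p.2.1‖ ^ 2 + ‖p.2.2 - x‖ ^ 2))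
    (a + (1 / 2) * φ (2 * |y|) + 2 * lam * ‖x‖ ^ 2 + |f (y, 0, x)|)
    (by have := hφabs y; positivity)
    (fun p ↦ by have := hφabs (p.1 - y); positivity)
    (by
      rintro ⟨u, z, w⟩
      have hφu : φ |u| ≤ 1 / 2 * φ (2 * |u - y|) + 1 / 2 * φ (2 * |y|) := by
        have hconv := hφ_conv.2 (x := 2 * |u - y|) (y := 2 * |y|) (by simp) (by simp)
          (by norm_num : (0 : ℝ) ≤ 1 / 2) (by norm_num : (0 : ℝ) ≤ 1 / 2) (by norm_num)
        simp only [smul_eq_mul] at hconv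
        refine le_trans (hφ_mono.monotoneOn (by simp) ?_ ?_) hconv
        · simp only [Set.mem_Ici]
          positivity
        · have := abs_add_le (u - y) y
          rw [sub_add_cancel] at this
          linarith
      have hw : ‖w‖ ^ 2 ≤ 2 * ‖w - x‖ ^ 2 + 2 * ‖x‖ ^ 2 := by
        have := norm_add_le (w - x) x
        rw [sub_add_cancel] at this
        nlinarith [norm_nonneg w, sq_nonneg (‖w - x‖ - ‖x‖)]
      have hb := hbound (u, z, w)
      have hsub := abs_sub (f (u, z, w)) (f (y, 0, x))
      dsimp only at hb ⊢
      nlinarith [mul_le_mul_of_nonneg_left hw hlam.le, mul_nonneg hlam.le (sq_nonneg ‖z‖)])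
    (by
      intro ε hε
      obtain ⟨δ, hδ, h⟩ := Metric.continuous_iff.1 hf (y, 0, x) ε hε
      have hφδ : 0 < φ (2 * δ) := by
        rw [← hφ_zero]
        exact hφ_mono (by simp) (by simp [hδ.le]) (by linarith)
      refine ⟨min (1 / 2 * φ (2 * δ)) (2 * lam * δ ^ 2), by positivity, ?_⟩
      rintro ⟨u, z, w⟩ hG
      obtain ⟨hG1, hG2⟩ := lt_min_iff.1 hG
      dsimp only at hG1 hG2
      have hφu := hφabs (u - y)
      have hu : |u - y| < δ := by
        have hlt : φ (2 * |u - y|) < φ (2 * δ) := by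
          have : 0 ≤ 2 * lam * (‖z‖ ^ 2 + ‖w - x‖ ^ 2) := by positivity
          linarith
        have := (hφ_mono.lt_iff_lt (by simp) (by simp [hδ.le])).1 hlt
        linarith
      have hzw : ‖z‖ ^ 2 + ‖w - x‖ ^ 2 < δ ^ 2 :=
        lt_of_mul_lt_mul_left (a := 2 * lam) (by linarith) (by positivity)
      have hz : ‖z‖ < δ := lt_of_pow_lt_pow_left₀ 2 hδ.le (by nlinarith [sq_nonneg ‖w - x‖])
      have hw : ‖w - x‖ < δ := lt_of_pow_lt_pow_left₀ 2 hδ.le (by nlinarith [sq_nonneg ‖z‖])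
      have := h (u, z, w) (by
        rw [Prod.dist_eq, Prod.dist_eq, Real.dist_eq, dist_zero_right, dist_eq_norm]
        exact max_lt hu (max_lt hz hw))
      simpa only [Real.dist_eq] using this)
  refine ⟨c, hc0, fun n ↦ ?_, hct, fun n hn u z w ↦ ?_⟩
  · have hM := (hc0 n).trans (hcM n)
    linarith [hcM n]
  · have := hc n hn (u, z, w)
    dsimp only at this
    linarith
end
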